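/- arXiv:1904.12851 — 2 statements merged into one kernel-verified Lean document; each statement's English description precedes it below -/
import Mathlib

section
/- Assume k = ℂ and Q, q are generic. Let u_d^+ := ∏_{j=1}^d (K_j + Q) and u_d^− := ∏_{j=1}^d (K_j − Q^{−1}), as endomorphisms of V_n^{⊗d} (the K_j pairwise commute, so the products are well defined). Then the image of u_d^+ equals the span of all simultaneous eigenvectors v of K_1, …, K_d whose K_j-eigenvalues are all of the form Q^{−1} q^{2m} (m ∈ ℤ), and the image of u_d^− equals the span of all simultaneous eigenvectors of K_1, …, K_d whose eigenvalues are all of the form −Q q^{2m} (m ∈ ℤ). -/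
noncomputable section
namespace QSP

variable {k : Type*} [Field k]

/-- Doubled value of a basis index: `val n j = 2*j - (n-1)`, so that the basis
indices of `V_n` are the integers/half-integers `val/2` in `𝕀_n`. -/
def val (n : ℕ) (j : Fin n) : ℤ := 2 * (j : ℤ) - ((n : ℤ) - 1)

/-- Matrix of the operator `K_Q` on `V_n` in the standard basis. -/
def KQmat (Q : k) (n : ℕ) : Matrix (Fin n) (Fin n) k := fun c b =>
  if val n b = 0 then (if c = b then Q⁻¹ else 0)
  else (if c = Fin.rev b then 1 else 0) + (if val n b < 0 ∧ c = b then Q⁻¹ - Q else 0)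

/-- Matrix of the operator `R_q` on `V_n ⊗ V_n` in the standard basis. -/
def Rmat (q : k) (n : ℕ) : Matrix (Fin n × Fin n) (Fin n × Fin n) k := fun c b =>
  if b.1 = b.2 then (if c = b then q⁻¹ else 0)
  else if b.1 < b.2 then (if c = (b.2, b.1) then 1 else 0)
  else (if c = (b.2, b.1) then 1 else 0) + (if c = b then q⁻¹ - q else 0)

/-- The operators `T_i`, `0 ≤ i ≤ d-1`, on `V_n^{⊗ d}`; `T_0` acts as `K_Q` on the
first tensor factor, and `T_i` (for `i > 0`) acts as `R_q` on the `(i, i+1)`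
tensor factors (1-based). -/
def TB (Q q : k) (n d : ℕ) (i : ℕ) : Module.End k ((Fin d → Fin n) → k) :=
  if _h0 : i = 0 then
    if hd : 0 < d then
      Matrix.toLin' (fun c b =>
        if ∀ j, j ≠ (⟨0, hd⟩ : Fin d) → c j = b j then
          KQmat Q n (c ⟨0, hd⟩) (b ⟨0, hd⟩) else 0)
    else 0
  else if hi : i < d then
    Matrix.toLin' (fun c b =>
      if ∀ j, j ≠ (⟨i - 1, Nat.lt_of_le_of_lt (Nat.pred_le i) hi⟩ : Fin d) →
          j ≠ (⟨i, hi⟩ : Fin d) → c j = b j then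
        Rmat q n (c ⟨i - 1, Nat.lt_of_le_of_lt (Nat.pred_le i) hi⟩, c ⟨i, hi⟩)
          (b ⟨i - 1, Nat.lt_of_le_of_lt (Nat.pred_le i) hi⟩, b ⟨i, hi⟩) else 0)
  else 0

/-- The Jucys–Murphy elements `K_i = T_{i-1} ⋯ T_1 T_0 T_1 ⋯ T_{i-1}` acting on
`V_n^{⊗ d}`, for `1 ≤ i ≤ d` (junk value `1` for `i = 0`). -/
def JM (Q q : k) (n d : ℕ) : ℕ → Module.End k ((Fin d → Fin n) → k)
  | 0 => 1
  | 1 => TB Q q n d 0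
  | i + 2 => TB Q q n d (i + 1) * JM Q q n d (i + 1) * TB Q q n d (i + 1)

/-- The element `c_K = K_1 K_2 ⋯ K_d` acting on `V_n^{⊗ d}`. -/
def cK (Q q : k) (n d : ℕ) : Module.End k ((Fin d → Fin n) → k) :=
  ((List.range d).map (fun i => JM Q q n d (i + 1))).prod


section abs
variable {A : Type*} [Ring A]

def JJ (t : ℕ → A) : ℕ → A
  | 0 => 1
  | 1 => t 0
  | i + 2 => t (i + 1) * JJ t (i + 1) * t (i + 1)

structure BR (t : ℕ → A) : Prop where
  far : ∀ i j, i + 2 ≤ j → t i * t j = t j * t i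
  braid : ∀ i, 1 ≤ i → t i * t (i+1) * t i = t (i+1) * t i * t (i+1)
  four : t 0 * t 1 * t 0 * t 1 = t 1 * t 0 * t 1 * t 0

lemma JJ_succ (t : ℕ → A) (i : ℕ) (hi : 1 ≤ i) : JJ t (i+1) = t i * JJ t i * t i := by
  obtain ⟨j, rfl⟩ : ∃ j, i = j + 1 := ⟨i - 1, by omega⟩
  rfl

lemma comm_a {t : ℕ → A} (h : BR t) (i j : ℕ) (hij : i + 1 ≤ j) : Commute (t j) (JJ t i) := by
  induction i with
  | zero => exact Commute.one_right _
  | succ i ih =>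
    rcases Nat.eq_zero_or_pos i with rfl | hi
    · exact (h.far 0 j (by omega)).symm
    · rw [JJ_succ t i hi]
      have h1 : Commute (t j) (t i) := (h.far i j (by omega)).symm
      exact (h1.mul_right (ih (by omega))).mul_right h1

lemma comm_b {t : ℕ → A} (h : BR t) (j : ℕ) (hj : 1 ≤ j) (i : ℕ) (hij : j + 2 ≤ i) :
    Commute (t j) (JJ t i) := by
  induction i, hij using Nat.le_induction with
  | base =>
    rw [JJ_succ t (j+1) (by omega), JJ_succ t j hj]
    have h1 := h.braid j hj
    have h2 : t (j+1) * JJ t j = JJ t j * t (j+1) := comm_a h j (j+1) (by omega)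
    show _ = _
    calc t j * (t (j+1) * (t j * JJ t j * t j) * t (j+1))
        = (t j * t (j+1) * t j) * JJ t j * t j * t (j+1) := by noncomm_ring
      _ = t (j+1) * t j * (t (j+1) * JJ t j) * t j * t (j+1) := by rw [h1]; noncomm_ring
      _ = t (j+1) * t j * JJ t j * (t (j+1) * t j * t (j+1)) := by rw [h2]; noncomm_ring
      _ = _ := by rw [← h1]; noncomm_ring
  | succ i hi ih =>
    rw [JJ_succ t i (by omega)]
    have h1 : Commute (t j) (t i) := (h.far j i (by omega))
    exact (h1.mul_right ih).mul_right h1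

lemma comm_J {t : ℕ → A} (h : BR t) (j : ℕ) : ∀ i, 1 ≤ i → i ≤ j → Commute (JJ t i) (JJ t j) := by
  induction j with
  | zero => intro i h1 h2; omega
  | succ j ih =>
    intro i hi hij
    have key : ∀ i, 1 ≤ i → i < j → Commute (JJ t i) (JJ t (j+1)) := by
      intro i hi hij
      rw [JJ_succ t j (by omega)]
      have h1 := (comm_a h i j (by omega)).symm
      exact (h1.mul_right (ih i hi hij.le)).mul_right h1
    rcases Nat.lt_or_ge i j with h1 | h1
    · exact key i hi h1
    · rcases Nat.eq_or_lt_of_le h1 with rfl | h2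
      · rcases Nat.eq_or_lt_of_le hi with rfl | h3
        · have := h.four
          show t 0 * (t 1 * t 0 * t 1) = (t 1 * t 0 * t 1) * t 0
          rw [← this]; noncomm_ring
        · obtain ⟨m, rfl⟩ : ∃ m, j = m + 1 := ⟨j - 1, by omega⟩
          conv_lhs => rw [JJ_succ t m (by omega)]
          have e1 := comm_b h m (by omega) (m+1+1) (by omega)
          have e2 := key m (by omega) (by omega)
          exact (e1.mul_left e2).mul_left e1
      · have : i = j + 1 := by omega
        subst this; exact Commute.refl _

lemma comm_J' {t : ℕ → A} (h : BR t) (i j : ℕ) (hi : 1 ≤ i) (hj : 1 ≤ j) :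
    Commute (JJ t i) (JJ t j) := by
  rcases le_total i j with h1 | h1
  · exact comm_J h j i hi h1
  · exact (comm_J h i j hj h1).symm

end abs

section alg
variable {A : Type*} [Ring A] [Algebra ℂ A]

def UU (t : ℕ → A) (b : ℂ) (k : ℕ) : A :=
  ((List.range k).map (fun j => JJ t (j+1) - b • (1 : A))).prod

lemma UU_succ (t : ℕ → A) (b : ℂ) (k : ℕ) :
    UU t b (k+1) = UU t b k * (JJ t (k+1) - b • (1 : A)) := by
  simp [UU, List.range_succ]

lemma comm_sub {x y : A} (h : Commute x y) (b : ℂ) : Commute x (y - b • (1 : A)) :=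
  h.sub_right ((Commute.one_right x).smul_right b)

lemma comm_JU {t : ℕ → A} (h : BR t) (b : ℂ) (i : ℕ) (hi : 1 ≤ i) (k : ℕ) :
    Commute (JJ t i) (UU t b k) := by
  induction k with
  | zero => exact Commute.one_right _
  | succ k ih =>
    rw [UU_succ]
    exact ih.mul_right (comm_sub (comm_J' h i (k+1) hi (by omega)) b)

lemma comm_d {t : ℕ → A} (h : BR t) (b z : ℂ) (i : ℕ) (hi : 1 ≤ i)
    (hq : t i * t i = z • t i + 1) :
    Commute (t i) ((JJ t i - b • (1 : A)) * (JJ t (i+1) - b • (1 : A))) := by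
  have hc : JJ t i * JJ t (i+1) = JJ t (i+1) * JJ t i := comm_J' h i (i+1) hi (by omega)
  have e1 : Commute (t i) (JJ t i * JJ t (i+1)) := by
    show _ = _
    have : t i * (JJ t i * JJ t (i+1)) = (t i * JJ t i * t i) * JJ t i * t i := by
      rw [JJ_succ t i hi]; noncomm_ring
    rw [this, ← JJ_succ t i hi, ← hc]
  have e2 : Commute (t i) (JJ t i + JJ t (i+1)) := by
    show _ = _
    have a1 : t i * JJ t (i+1) = JJ t i * t i + z • JJ t (i+1) := by
      have : t i * JJ t (i+1) = (t i * t i) * JJ t i * t i := by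
        rw [JJ_succ t i hi]; noncomm_ring
      rw [this, hq, JJ_succ t i hi, add_mul, add_mul, one_mul, smul_mul_assoc, smul_mul_assoc, add_comm]
    have a2 : JJ t (i+1) * t i = t i * JJ t i + z • JJ t (i+1) := by
      have : JJ t (i+1) * t i = t i * JJ t i * (t i * t i) := by
        rw [JJ_succ t i hi]; noncomm_ring
      rw [this, hq, JJ_succ t i hi, mul_add, mul_one, mul_smul_comm, add_comm]
    rw [mul_add, add_mul, a1, a2]; abel
  have : (JJ t i - b • (1 : A)) * (JJ t (i+1) - b • (1 : A)) =
      JJ t i * JJ t (i+1) - b • (JJ t i + JJ t (i+1)) + (b*b) • (1:A) := by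
    simp only [sub_mul, mul_sub, smul_mul_assoc, mul_smul_comm, mul_one, one_mul, smul_sub, smul_add,
      smul_smul]
    abel
  rw [this]
  exact (e1.sub_right (e2.smul_right b)).add_right ((Commute.one_right _).smul_right _)

lemma comm_TU {t : ℕ → A} (h : BR t) (b z : ℂ) (i : ℕ) (hi : 1 ≤ i)
    (hq : t i * t i = z • t i + 1) (d : ℕ) (hd : i < d) :
    Commute (t i) (UU t b d) := by
  induction d, (show i + 1 ≤ d from hd) using Nat.le_induction with
  | base =>
    obtain ⟨m, rfl⟩ : ∃ m, i = m + 1 := ⟨i - 1, by omega⟩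
    rw [UU_succ, UU_succ, mul_assoc]
    refine Commute.mul_right ?_ (comm_d h b z (m+1) hi hq)
    have : ∀ k, k ≤ m → Commute (t (m+1)) (UU t b k) := by
      intro k
      induction k with
      | zero => intro _; exact Commute.one_right _
      | succ k ih =>
        intro hk
        rw [UU_succ]
        exact (ih (by omega)).mul_right (comm_sub (comm_a h (k+1) (m+1) (by omega)) b)
    exact this m le_rfl
  | succ k hk ih =>
    rw [UU_succ]
    exact (ih (by omega)).mul_right (comm_sub (comm_b h i hi (k+1) (by omega)) b)

lemma T0U {t : ℕ → A} (a b : ℂ) (h0 : (t 0 - a • (1:A)) * (t 0 - b • (1:A)) = 0)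
    (d : ℕ) (hd : 1 ≤ d) : t 0 * UU t b d = a • UU t b d := by
  have : (t 0 - a • (1:A)) * UU t b d = 0 := by
    induction d, hd using Nat.le_induction with
    | base => simpa [UU, JJ] using h0
    | succ k hk ih => rw [UU_succ, ← mul_assoc, ih, zero_mul]
  rw [sub_mul, smul_mul_assoc, one_mul, sub_eq_zero] at this
  exact this

def tA (t : ℕ → A) (i : ℕ) : A := if i = 0 then 1 else t i

lemma JU_eq {t : ℕ → A} (h : BR t) (a b z : ℂ)
    (h0 : (t 0 - a • (1:A)) * (t 0 - b • (1:A)) = 0) (d : ℕ) 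
    (hq : ∀ i, 1 ≤ i → i < d → t i * t i = z • t i + 1)
    (j : ℕ) (hj : 1 ≤ j) (hjd : j ≤ d) :
    JJ t j * UU t b d = a • (JJ (tA t) j * UU t b d) := by
  induction j, hj using Nat.le_induction with
  | base => 
    have := T0U a b h0 d hjd
    simpa [JJ, tA] using this
  | succ j hj ih =>
    have c : t j * UU t b d = UU t b d * t j := comm_TU h b z j hj (hq j hj (by omega)) d (by omega)
    have e : tA t j = t j := by simp [tA]; omega
    rw [JJ_succ t j hj, JJ_succ (tA t) j hj, e, mul_assoc, c, mul_assoc, ← mul_assoc (JJ t j),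
      ih (by omega), mul_assoc (t j * _), c, smul_mul_assoc, mul_smul_comm]
    noncomm_ring

lemma BR_tA {t : ℕ → A} (h : BR t) : BR (tA t) where
  far i j hij := by
    have : j ≠ 0 := by omega
    by_cases hi : i = 0
    · simp [tA, hi]
    · simpa [tA, hi, this] using h.far i j hij
  braid i hi := by
    have : i ≠ 0 := by omega
    simpa [tA, this] using h.braid i hi
  four := by simp [tA]

end alg

section lin
variable {V : Type*} [AddCommGroup V] [Module ℂ V]

def PP (f : Module.End ℂ V) (l : List ℂ) : Module.End ℂ V :=
  (l.map (fun s => f - s • (1 : Module.End ℂ V))).prod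

lemma PP_cons (f : Module.End ℂ V) (s : ℂ) (l : List ℂ) (x : V) :
    PP f (s :: l) x = f (PP f l x) - s • PP f l x := by
  simp [PP]

lemma PP_eig (f : Module.End ℂ V) (l : List ℂ) (s : ℂ) (x : V) (hx : f x = s • x) :
    PP f l x = (l.map (fun t => s - t)).prod • x := by
  induction l with
  | nil => simp [PP]
  | cons t l ih =>
    rw [PP_cons, ih]
    simp only [map_smul, hx, List.map_cons, List.prod_cons]
    module

lemma decomp (f : Module.End ℂ V) (N : Submodule ℂ V) (hN : ∀ x ∈ N, f x ∈ N)
    (l : List ℂ) (hl : l.Nodup) : ∀ x ∈ N, PP f l x = 0 →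
      x ∈ Submodule.span ℂ {y | y ∈ N ∧ ∃ s ∈ l, f y = s • y} := by
  induction l with
  | nil => intro x _ hx; simp [PP] at hx; simp [hx]
  | cons s l ih =>
    intro x hx h
    have hPN : ∀ l' : List ℂ, PP f l' x ∈ N := by
      intro l'
      induction l' with
      | nil => simpa [PP] using hx
      | cons a l' ih' => rw [PP_cons]; exact N.sub_mem (hN _ ih') (N.smul_mem _ ih')
    rw [PP_cons, sub_eq_zero] at h
    rw [List.nodup_cons] at hl
    set y := PP f l x with hy
    set c := (l.map (fun t => s - t)).prod with hc
    have hc0 : c ≠ 0 := by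
      rw [hc]; intro h0
      rw [List.prod_eq_zero_iff] at h0
      simp only [List.mem_map] at h0
      obtain ⟨t, ht, h1⟩ := h0
      rw [sub_eq_zero] at h1
      exact hl.1 (h1 ▸ ht)
    have h2 : PP f l (x - c⁻¹ • y) = 0 := by
      rw [map_sub, map_smul, PP_eig f l s y h, ← hc, smul_smul, inv_mul_cancel₀ hc0, one_smul, ← hy,
        sub_self]
    have h3 := ih hl.2 (x - c⁻¹ • y) (N.sub_mem hx (N.smul_mem _ (hPN l))) h2
    have h4 : x = (x - c⁻¹ • y) + c⁻¹ • y := by abel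
    rw [h4]
    refine Submodule.add_mem _ (Submodule.span_mono ?_ h3) (Submodule.smul_mem _ _ (Submodule.subset_span ?_))
    · rintro w ⟨h5, r, h6, h7⟩
      exact ⟨h5, r, List.mem_cons_of_mem _ h6, h7⟩
    · exact ⟨hPN l, s, List.mem_cons_self, h⟩

lemma joint (K L : ℕ → Module.End ℂ V) (W : Submodule ℂ V) (a : ℂ) (d : ℕ) (l : List ℂ)
    (hl : l.Nodup)
    (hW : ∀ j, 1 ≤ j → j ≤ d → ∀ x ∈ W, K j x ∈ W)
    (hK : ∀ i j, 1 ≤ i → 1 ≤ j → Commute (K i) (K j)) (ha : a ≠ 0)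
    (hKL : ∀ j, 1 ≤ j → j ≤ d → ∀ x ∈ W, K j x = a • L j x)
    (hP : ∀ j, 1 ≤ j → j ≤ d → PP (L j) l = 0) (k : ℕ) (hk : k ≤ d) :
    W ≤ Submodule.span ℂ {v | v ∈ W ∧ ∀ j, 1 ≤ j → j ≤ k → ∃ s ∈ l, K j v = (a * s) • v} := by
  induction k with
  | zero => 
    intro x hx
    exact Submodule.subset_span ⟨hx, fun j h1 h2 => by omega⟩
  | succ k ih =>
    refine (ih (by omega)).trans (Submodule.span_le.2 ?_)
    rintro v ⟨hv, hv2⟩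
    have : ∃ s : ℕ → ℂ, ∀ j, 1 ≤ j → j ≤ k → s j ∈ l ∧ K j v = (a * s j) • v := by
      classical
      refine ⟨fun j => if h : 1 ≤ j ∧ j ≤ k then (hv2 j h.1 h.2).choose else 0, fun j h1 h2 => ?_⟩
      simp only [h1, h2, and_self, dif_pos]
      exact (hv2 j h1 h2).choose_spec
    obtain ⟨s, hs⟩ := this
    let N : Submodule ℂ V :=
      { carrier := {y | y ∈ W ∧ ∀ j, 1 ≤ j → j ≤ k → K j y = (a * s j) • y}
        zero_mem' := ⟨W.zero_mem, by simp⟩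
        add_mem' := by
          rintro x y ⟨h1, h2⟩ ⟨h3, h4⟩
          exact ⟨W.add_mem h1 h3, fun j h h' => by rw [map_add, h2 j h h', h4 j h h', smul_add]⟩
        smul_mem' := by
          rintro c x ⟨h1, h2⟩
          exact ⟨W.smul_mem _ h1, fun j h h' => by rw [map_smul, h2 j h h', smul_comm]⟩ }
    have hLK : ∀ x ∈ W, L (k+1) x = a⁻¹ • K (k+1) x := by
      intro x hx
      rw [hKL (k+1) (by omega) hk x hx, smul_smul, inv_mul_cancel₀ ha, one_smul]
    have hN : ∀ x ∈ N, L (k+1) x ∈ N := by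
      rintro x ⟨h1, h2⟩
      rw [hLK x h1]
      refine N.smul_mem _ ⟨hW _ (by omega) hk x h1, fun j h h' => ?_⟩
      have := LinearMap.congr_fun (hK j (k+1) h (by omega)).eq x
      simp only [Module.End.mul_apply] at this
      rw [this, h2 j h h', map_smul]
    have := decomp (L (k+1)) N hN l hl v ⟨hv, fun j h h' => (hs j h h').2⟩
      (by rw [hP (k+1) (by omega) hk]; rfl)
    refine Submodule.span_mono ?_ this
    rintro y ⟨⟨h1, h2⟩, r, h3, h4⟩
    refine ⟨h1, fun j h h' => ?_⟩
    rcases Nat.eq_or_lt_of_le h' with rfl | h5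
    · exact ⟨r, h3, by rw [hKL (k+1) (by omega) hk y h1, h4, smul_smul]⟩
    · exact ⟨s j, (hs j h (by omega)).1, h2 j h (by omega)⟩

/-- eigenvalues of the type A Jucys-Murphy elements -/
lemma eigA [FiniteDimensional ℂ V] {t : ℕ → Module.End ℂ V} (h : BR t) (q : ℂ) (hq0 : q ≠ 0)
    (h1 : t 0 = 1) (d : ℕ)
    (hq : ∀ i, 1 ≤ i → i < d → t i * t i = (q⁻¹ - q) • t i + 1)
    (j : ℕ) (hj : 1 ≤ j) (hjd : j ≤ d) : ∀ (c : ℂ) (v : V), v ≠ 0 → JJ t j v = c • v →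
      ∃ m : ℤ, |m| < j ∧ c = q ^ (2 * m) := by
  induction j, hj using Nat.le_induction with
  | base =>
    intro c v hv hc
    refine ⟨0, by simp, ?_⟩
    simp only [JJ, h1, Module.End.one_apply] at hc
    have : (1 - c) • v = 0 := by rw [sub_smul, one_smul, ← hc, sub_self]
    rcases smul_eq_zero.1 this with h2 | h2
    · rw [sub_eq_zero] at h2; simp [← h2]
    · exact absurd h2 hv
  | succ j hj ih =>
    intro lam v0 hv0 hlam0
    have ih := ih (by omega)
    have hcom := comm_J' h j (j+1) hj (by omega)
    -- joint eigenvector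
    obtain ⟨v, mu, hv, hlam, hmu⟩ : ∃ (v : V) (mu : ℂ), v ≠ 0 ∧ JJ t (j+1) v = lam • v ∧ 
        JJ t j v = mu • v := by
      have hmaps : ∀ x ∈ Module.End.eigenspace (JJ t (j+1)) lam, 
          JJ t j x ∈ Module.End.eigenspace (JJ t (j+1)) lam := by
        intro x hx
        rw [Module.End.mem_eigenspace_iff] at hx ⊢
        have := LinearMap.congr_fun hcom.eq x
        simp only [Module.End.mul_apply] at this
        rw [← this, hx, map_smul]
      have hnt : Nontrivial (Module.End.eigenspace (JJ t (j+1)) lam) := by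
        refine ⟨⟨⟨v0, Module.End.mem_eigenspace_iff.2 hlam0⟩, 0, ?_⟩⟩
        intro h; exact hv0 (by simpa using congrArg Subtype.val h)
      obtain ⟨mu, hmu⟩ := Module.End.exists_eigenvalue ((JJ t j).restrict hmaps)
      obtain ⟨w, hw⟩ := hmu.exists_hasEigenvector
      refine ⟨w, mu, ?_, Module.End.mem_eigenspace_iff.1 w.2, ?_⟩
      · intro h; exact hw.2 (Subtype.ext h)
      · have := hw.apply_eq_smul
        simpa using congrArg Subtype.val this
    have hqj := hq j hj (by omega)
    set z := q⁻¹ - q with hz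
    have hTT : ∀ x, t j (t j x) = z • t j x + x := fun x => by
      have := LinearMap.congr_fun hqj x
      simpa using this
    by_cases hprop : ∃ τ : ℂ, t j v = τ • v
    · obtain ⟨τ, hτ⟩ := hprop
      have e1 : (τ * τ - z * τ - 1) • v = 0 := by
        have := hTT v
        rw [hτ, map_smul, hτ] at this
        have h3 : (τ * τ - z * τ - 1) • v = τ • τ • v - (z • τ • v + v) := by module
        rw [h3, this, sub_self]
      have e1 := (smul_eq_zero.1 e1).resolve_right hv
      have e2 : (lam - τ * τ * mu) • v = 0 := by
        have := hlam
        rw [JJ_succ t j hj] at this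
        simp only [Module.End.mul_apply, hτ, map_smul, hmu] at this
        rw [sub_smul, ← this]; module
      have e2 := (smul_eq_zero.1 e2).resolve_right hv
      obtain ⟨m, hm, hm2⟩ := ih mu v hv hmu
      have e3 : (τ - q⁻¹) * (τ + q) = 0 := by
        have : (τ - q⁻¹) * (τ + q) = τ * τ - z * τ - 1 + (1 - q⁻¹ * q) := by rw [hz]; ring
        rw [this, e1, inv_mul_cancel₀ hq0]; ring
      have hab := abs_lt.1 hm
      rcases mul_eq_zero.1 e3 with e4 | e4
      · refine ⟨m - 1, by rw [abs_lt]; push_cast; omega, ?_⟩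
        have : τ = q⁻¹ := by linear_combination e4
        rw [show 2 * (m - 1) = 2 * m + (-1) + (-1) by ring, zpow_add₀ hq0, zpow_add₀ hq0, ← hm2, zpow_neg_one]
        rw [this] at e2; linear_combination e2
      · refine ⟨m + 1, by rw [abs_lt]; push_cast; omega, ?_⟩
        have : τ = -q := by linear_combination e4
        rw [show 2 * (m + 1) = 2 * m + 1 + 1 by ring, zpow_add₀ hq0, zpow_add₀ hq0, ← hm2, zpow_one]
        rw [this] at e2; linear_combination e2
    · suffices hs : ∃ x, x ≠ 0 ∧ JJ t j x = lam • x by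
        obtain ⟨x, hx, hx2⟩ := hs
        obtain ⟨m, hm, hm2⟩ := ih lam x hx hx2
        exact ⟨m, by push_cast; omega, hm2⟩
      by_cases hlm : lam = mu
      · exact ⟨v, hv, by rw [hmu, hlm]⟩
      have hlm' : lam - mu ≠ 0 := sub_ne_zero.2 hlm
      have e1 : JJ t j (t j v) = lam • t j v - (lam * z) • v := by
        have h3 : t j (JJ t j (t j v)) = lam • v := by
          have := hlam
          rw [JJ_succ t j hj] at this
          simpa using this
        have h4 := hTT (JJ t j (t j v))
        rw [h3, map_smul] at h4
        rw [eq_comm, ← eq_sub_iff_add_eq'] at h4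
        rw [h4]; module
      refine ⟨t j v - (lam * z / (lam - mu)) • v, ?_, ?_⟩
      · intro h0; exact hprop ⟨_, sub_eq_zero.1 h0⟩
      · rw [map_sub, map_smul, hmu, e1]
        have : lam * z = (lam * z / (lam - mu)) * (lam - mu) := by field_simp
        set al := lam * z / (lam - mu)
        rw [this]; module

end lin

section herm
variable {ι : Type*} [Fintype ι]

def Sym (f : Module.End ℂ (ι → ℂ)) : Prop :=
  ∀ x y : ι → ℂ, star x ⬝ᵥ f y = star (f x) ⬝ᵥ y

lemma Sym.sandwich {f g : Module.End ℂ (ι → ℂ)} (hf : Sym f) (hg : Sym g) : Sym (g * f * g) := by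
  intro x y
  simp only [Module.End.mul_apply]
  rw [hg, hf, hg]

open scoped ComplexOrder in
lemma Sym.ker {f : Module.End ℂ (ι → ℂ)} (hf : Sym f) (x : ι → ℂ) (h : f (f x) = 0) : f x = 0 := by
  have := hf x (f x)
  rw [h, dotProduct_zero] at this
  exact dotProduct_star_self_eq_zero.1 this.symm

lemma Sym.ker_pow {f : Module.End ℂ (ι → ℂ)} (hf : Sym f) (k : ℕ) (x : ι → ℂ) 
    (h : (f ^ (k+1)) x = 0) : f x = 0 := by
  induction k with
  | zero => simpa using h
  | succ k ih =>
    apply ih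
    rw [pow_succ', Module.End.mul_apply] 
    apply hf.ker
    rw [pow_succ', pow_succ'] at h
    simpa using h

lemma Sym.PP_zero {f : Module.End ℂ (ι → ℂ)} (hf : Sym f) (l : List ℂ) 
    (hl : ∀ s ∈ l, star s = s)
    (he : ∀ c v, v ≠ 0 → f v = c • v → c ∈ l) : PP f l = 0 := by
  rw [← LinearMap.ker_eq_top, eq_top_iff, ← Module.End.iSup_maxGenEigenspace_eq_top f, iSup_le_iff]
  intro mu x hx
  rw [LinearMap.mem_ker]
  by_cases hx0 : x = 0
  · simp [hx0]
  have hmem : mu ∈ l := by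
    by_contra hmu
    have hev : ¬ f.HasEigenvalue mu := by
      intro h
      obtain ⟨w, hw⟩ := h.exists_hasEigenvector
      exact hmu (he mu w hw.2 hw.apply_eq_smul)
    rw [Module.End.mem_maxGenEigenspace] at hx
    obtain ⟨k, hk⟩ := hx
    have hinj : ∀ y, (f - mu • (1 : Module.End ℂ (ι → ℂ))) y = 0 → y = 0 := by
      intro y hy
      by_contra hy0
      simp only [LinearMap.sub_apply, LinearMap.smul_apply, Module.End.one_apply, sub_eq_zero] at hy
      exact hmu (he mu y hy0 hy)
    have : ∀ k, ((f - mu • (1 : Module.End ℂ (ι → ℂ))) ^ k) x = 0 → x = 0 := by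
      intro k
      induction k with
      | zero => intro h; simpa using h
      | succ k ih => intro h; rw [pow_succ', Module.End.mul_apply] at h; exact ih (hinj _ h)
    exact hx0 (this k hk)
  have hsym : Sym (f - mu • (1 : Module.End ℂ (ι → ℂ))) := by
    intro x y
    simp only [LinearMap.sub_apply, LinearMap.smul_apply, Module.End.one_apply, dotProduct_sub,
      star_sub, sub_dotProduct, star_smul, hl mu hmem, dotProduct_smul, smul_dotProduct]
    rw [hf x y]
  rw [Module.End.mem_maxGenEigenspace] at hx
  obtain ⟨k, hk⟩ := hx
  have h1 := hsym.ker_pow k x (by rw [pow_succ', Module.End.mul_apply, hk, map_zero])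
  simp only [LinearMap.sub_apply, LinearMap.smul_apply, Module.End.one_apply, sub_eq_zero] at h1
  rw [PP_eig f l mu x h1]
  have : (l.map (fun t => mu - t)).prod = 0 := by
    rw [List.prod_eq_zero_iff]
    exact List.mem_map.2 ⟨mu, hmem, sub_self _⟩
  rw [this, zero_smul]

end herm
section conc
variable {k : Type*} [Field k]

def aR (q : k) {n : ℕ} (x y : Fin n) : k := if x = y then q⁻¹ else if y < x then q⁻¹ - q else 0
def bR (k : Type*) [Field k] {n : ℕ} (x y : Fin n) : k := if x = y then 0 else 1
def aK (Q : k) {n : ℕ} (x : Fin n) : k :=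
  if val n x = 0 then Q⁻¹ else if val n x < 0 then Q⁻¹ - Q else 0
def bK (k : Type*) [Field k] {n : ℕ} (x : Fin n) : k := if val n x = 0 then 0 else 1

def sw {n d : ℕ} (p p' : Fin d) (c : Fin d → Fin n) : Fin d → Fin n :=
  fun j => if j = p then c p' else if j = p' then c p else c j
def fl {n d : ℕ} (p : Fin d) (c : Fin d → Fin n) : Fin d → Fin n :=
  fun j => if j = p then Fin.rev (c p) else c j

lemma val_rev (n : ℕ) (x : Fin n) : val n (Fin.rev x) = - val n x := by
  simp only [val, Fin.val_rev]; have := x.2; omega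

lemma val_eq {n : ℕ} (x y : Fin n) : x = y ↔ val n x = val n y := by
  simp only [val, Fin.ext_iff]; omega

lemma val_lt {n : ℕ} (x y : Fin n) : x < y ↔ val n x < val n y := by
  simp only [val, Fin.lt_def]; omega

def rr (q : k) {n : ℕ} (c b : Fin n × Fin n) : k :=
  if b.1 = b.2 then (if c = b then q⁻¹ else 0)
  else if b.1 < b.2 then (if c = (b.2, b.1) then 1 else 0)
  else (if c = (b.2, b.1) then 1 else 0) + (if c = b then q⁻¹ - q else 0)

def kk (Q : k) {n : ℕ} (c b : Fin n) : k :=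
  if val n b = 0 then (if c = b then Q⁻¹ else 0)
  else (if c = Fin.rev b then 1 else 0) + (if val n b < 0 ∧ c = b then Q⁻¹ - Q else 0)

lemma TB_apply (Q q : k) (n d i : ℕ) (hi : i + 1 < d) (f : (Fin d → Fin n) → k) (c : Fin d → Fin n) :
    TB Q q n d (i+1) f c = aR q (c ⟨i, by omega⟩) (c ⟨i+1, hi⟩) * f c +
      bR k (c ⟨i, by omega⟩) (c ⟨i+1, hi⟩) * f (sw ⟨i, by omega⟩ ⟨i+1, hi⟩ c) := by
  have h0 : TB Q q n d (i+1) f c = ∑ b : Fin d → Fin n,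
      (if ∀ j, j ≠ (⟨i, by omega⟩ : Fin d) → j ≠ (⟨i+1, hi⟩ : Fin d) → c j = b j then
        rr q (c ⟨i, by omega⟩, c ⟨i+1, hi⟩) (b ⟨i, by omega⟩, b ⟨i+1, hi⟩) else 0) * f b := by
    unfold TB
    rw [dif_neg (by omega), dif_pos hi]
    rfl
  rw [h0]
  generalize hp : (⟨i, by omega⟩ : Fin d) = p
  generalize hp' : (⟨i+1, hi⟩ : Fin d) = p'
  have hne : p ≠ p' := by rw [← hp, ← hp']; simp
  have key : ∀ b : Fin d → Fin n,
      (if ∀ j, j ≠ p → j ≠ p' → c j = b j then rr q (c p, c p') (b p, b p') else 0) =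
      (if b = c then aR q (c p) (c p') else 0) + (if b = sw p p' c then bR k (c p) (c p') else 0) := by
    intro b
    have h1 : b = c ↔ (∀ j, j ≠ p → j ≠ p' → c j = b j) ∧ c p = b p ∧ c p' = b p' := by
      constructor
      · rintro rfl; simp
      · rintro ⟨h1, h2, h3⟩
        funext j
        by_cases e : j = p
        · rw [e, h2]
        by_cases e' : j = p'
        · rw [e', h3]
        exact (h1 j e e').symm
    have h2 : b = sw p p' c ↔ (∀ j, j ≠ p → j ≠ p' → c j = b j) ∧ c p = b p' ∧ c p' = b p := by
      constructor
      · rintro rfl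
        refine ⟨fun j e e' => by simp [sw, e, e'], by simp [sw, hne.symm], by simp [sw]⟩
      · rintro ⟨h1, h2, h3⟩
        funext j
        by_cases e : j = p
        · simp [sw, e, h3]
        by_cases e' : j = p'
        · simp [sw, e', h2, hne.symm]
        simp [sw, e, e', h1 j e e']
    rw [if_congr h1 rfl rfl, if_congr h2 rfl rfl]
    by_cases hc : ∀ j, j ≠ p → j ≠ p' → c j = b j
    · simp only [hc, implies_true, if_true, true_and, rr, aR, bR, Prod.mk.injEq]
      generalize c p = x
      generalize c p' = y
      generalize b p = z
      generalize b p' = w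
      rcases lt_trichotomy z w with h | h | h <;> grind
    · simp only [hc, if_false, false_and, add_zero]
  simp only [key, add_mul, Finset.sum_add_distrib, ite_mul, zero_mul, Finset.sum_ite_eq',
    Finset.sum_ite_eq, Finset.mem_univ, if_true]

lemma TB0_apply (Q q : k) (n d : ℕ) (hd : 0 < d) (f : (Fin d → Fin n) → k) (c : Fin d → Fin n) :
    TB Q q n d 0 f c = aK Q (c ⟨0, hd⟩) * f c + bK k (c ⟨0, hd⟩) * f (fl ⟨0, hd⟩ c) := by
  have h0 : TB Q q n d 0 f c = ∑ b : Fin d → Fin n,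
      (if ∀ j, j ≠ (⟨0, hd⟩ : Fin d) → c j = b j then kk Q (c ⟨0, hd⟩) (b ⟨0, hd⟩) else 0) * f b := by
    unfold TB
    rw [dif_pos rfl, dif_pos hd]
    rfl
  rw [h0]
  generalize (⟨0, hd⟩ : Fin d) = p
  have key : ∀ b : Fin d → Fin n,
      (if ∀ j, j ≠ p → c j = b j then kk Q (c p) (b p) else 0) =
      (if b = c then aK Q (c p) else 0) + (if b = fl p c then bK k (c p) else 0) := by
    intro b
    have h1 : b = c ↔ (∀ j, j ≠ p → c j = b j) ∧ c p = b p := by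
      constructor
      · rintro rfl; simp
      · rintro ⟨h1, h2⟩
        funext j
        by_cases e : j = p
        · rw [e, h2]
        exact (h1 j e).symm
    have h2 : b = fl p c ↔ (∀ j, j ≠ p → c j = b j) ∧ c p = Fin.rev (b p) := by
      constructor
      · rintro rfl
        refine ⟨fun j e => by simp [fl, e], by simp [fl]⟩
      · rintro ⟨h1, h2⟩
        funext j
        by_cases e : j = p
        · simp [fl, e, h2]
        simp [fl, e, h1 j e]
    rw [if_congr h1 rfl rfl, if_congr h2 rfl rfl]
    by_cases hc : ∀ j, j ≠ p → c j = b j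
    · simp only [hc, implies_true, if_true, true_and, kk, aK, bK]
      generalize c p = x
      generalize b p = z
      have := val_rev n z
      by_cases e1 : x = z
      · subst e1
        by_cases e2 : x = Fin.rev x
        · have e3 : val n x = 0 := by rw [← e2] at this; omega
          simp [e3]
        · have e3 : val n x ≠ 0 := by
            intro h; exact e2 ((val_eq _ _).2 (by omega))
          simp [e2, e3]
      · by_cases e2 : x = Fin.rev z
        · have e3 : val n z ≠ 0 := by
            intro h; apply e1; rw [e2]; exact (val_eq _ _).2 (by omega)
          have e4 : val n x ≠ 0 := by rw [e2]; omega
          simp [← e2, e1, e3, e4]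
        · simp [e1, e2]
    · simp only [hc, if_false, false_and, add_zero]
  simp only [key, add_mul, Finset.sum_add_distrib, ite_mul, zero_mul, Finset.sum_ite_eq',
    Finset.sum_ite_eq, Finset.mem_univ, if_true]

lemma TB_big (Q q : k) (n d i : ℕ) (hi : ¬ i < d) : TB Q q n d i = 0 := by
  unfold TB
  split_ifs <;> first | rfl | omega

lemma sw_p {n d : ℕ} (p p' : Fin d) (c : Fin d → Fin n) : sw p p' c p = c p' := by simp [sw]
lemma sw_p' {n d : ℕ} (p p' : Fin d) (c : Fin d → Fin n) : sw p p' c p' = c p := by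
  by_cases h : p' = p <;> simp [sw, h]
lemma sw_ne {n d : ℕ} (p p' j : Fin d) (h : j ≠ p) (h' : j ≠ p') (c : Fin d → Fin n) :
    sw p p' c j = c j := by simp [sw, h, h']
lemma sw_sw {n d : ℕ} (p p' : Fin d) (c : Fin d → Fin n) : sw p p' (sw p p' c) = c := by
  funext j; simp only [sw]; grind
lemma fl_p {n d : ℕ} (p : Fin d) (c : Fin d → Fin n) : fl p c p = Fin.rev (c p) := by simp [fl]
lemma fl_ne {n d : ℕ} (p j : Fin d) (h : j ≠ p) (c : Fin d → Fin n) :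
    fl p c j = c j := by simp [fl, h]
lemma fl_fl {n d : ℕ} (p : Fin d) (c : Fin d → Fin n) : fl p (fl p c) = c := by
  funext j; by_cases h : j = p <;> simp [fl, h]

lemma TB_quad (Q q : k) (hq : q ≠ 0) (n d i : ℕ) (h1 : 1 ≤ i) (hi : i < d) :
    TB Q q n d i * TB Q q n d i = (q⁻¹ - q) • TB Q q n d i + 1 := by
  obtain ⟨j, rfl⟩ : ∃ j, i = j + 1 := ⟨i - 1, by omega⟩
  refine LinearMap.ext fun f => ?_
  funext c
  have : q⁻¹ * q = 1 := inv_mul_cancel₀ hq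
  simp only [Module.End.mul_apply, LinearMap.add_apply, LinearMap.smul_apply, Module.End.one_apply,
    Pi.add_apply, Pi.smul_apply, smul_eq_mul, TB_apply Q q n d j hi, sw_p, sw_p', sw_sw]
  generalize c ⟨j, by omega⟩ = x
  generalize c ⟨j+1, hi⟩ = y
  simp only [aR, bR]
  rcases lt_trichotomy x y with h | h | h
  · simp [h.ne, h.ne', h, h.not_gt]
  · simp [h]; linear_combination (f c) * this
  · simp [h.ne, h.ne', h, h.not_gt]

lemma TB0_quad (Q q : k) (hQ : Q ≠ 0) (n d : ℕ) (hd : 0 < d) :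
    TB Q q n d 0 * TB Q q n d 0 = (Q⁻¹ - Q) • TB Q q n d 0 + 1 := by
  refine LinearMap.ext fun f => ?_
  funext c
  have : Q⁻¹ * Q = 1 := inv_mul_cancel₀ hQ
  simp only [Module.End.mul_apply, LinearMap.add_apply, LinearMap.smul_apply, Module.End.one_apply,
    Pi.add_apply, Pi.smul_apply, smul_eq_mul, TB0_apply Q q n d hd, fl_p, fl_fl]
  generalize c ⟨0, by omega⟩ = x
  simp only [aK, bK, val_rev]
  rcases lt_trichotomy (val n x) 0 with h | h | h
  · simp [h.ne, h, h.not_gt]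
  · simp [h]; linear_combination (f c) * this
  · simp [h.ne', h, h.not_gt]

lemma TB_far (Q q : k) (n d i j : ℕ) (hij : i + 2 ≤ j) :
    TB Q q n d i * TB Q q n d j = TB Q q n d j * TB Q q n d i := by
  by_cases hj : j < d
  swap
  · simp [TB_big Q q n d j hj]
  obtain ⟨j, rfl⟩ : ∃ m, j = m + 1 := ⟨j - 1, by omega⟩
  refine LinearMap.ext fun f => ?_
  funext c
  rcases Nat.eq_zero_or_pos i with rfl | hi
  · have n1 : (⟨0, by omega⟩ : Fin d) ≠ ⟨j, by omega⟩ := by simp; omega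
    have n2 : (⟨0, by omega⟩ : Fin d) ≠ ⟨j+1, by omega⟩ := by simp
    simp only [Module.End.mul_apply, TB_apply Q q n d j hj, TB0_apply Q q n d (by omega)]
    rw [fl_ne _ _ n1.symm, fl_ne _ _ n2.symm, sw_ne _ _ _ n1 n2]
    have : fl ⟨0, by omega⟩ (sw ⟨j, by omega⟩ ⟨j+1, hj⟩ c) = sw ⟨j, by omega⟩ ⟨j+1, hj⟩ (fl ⟨0, by omega⟩ c) := by
      funext l; simp only [fl, sw]; grind
    rw [this]; ring
  · obtain ⟨i, rfl⟩ : ∃ m, i = m + 1 := ⟨i - 1, by omega⟩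
    have n1 : (⟨i, by omega⟩ : Fin d) ≠ ⟨j, by omega⟩ := by simp; omega
    have n2 : (⟨i, by omega⟩ : Fin d) ≠ ⟨j+1, by omega⟩ := by simp; omega
    have n3 : (⟨i+1, by omega⟩ : Fin d) ≠ ⟨j, by omega⟩ := by simp; omega
    have n4 : (⟨i+1, by omega⟩ : Fin d) ≠ ⟨j+1, by omega⟩ := by simp; omega
    simp only [Module.End.mul_apply, TB_apply Q q n d j hj, TB_apply Q q n d i (by omega)]
    rw [sw_ne _ _ _ n1 n2, sw_ne _ _ _ n3 n4, sw_ne _ _ _ n1.symm n3.symm, sw_ne _ _ _ n2.symm n4.symm]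
    have : sw ⟨i, by omega⟩ ⟨i+1, by omega⟩ (sw ⟨j, by omega⟩ ⟨j+1, hj⟩ c) =
        sw ⟨j, by omega⟩ ⟨j+1, hj⟩ (sw ⟨i, by omega⟩ ⟨i+1, by omega⟩ c) := by
      funext l; simp only [sw]; grind
    rw [this]; ring

lemma TB_braid (Q q : k) (hq : q ≠ 0) (n d i : ℕ) (hi : 1 ≤ i) :
    TB Q q n d i * TB Q q n d (i+1) * TB Q q n d i =
      TB Q q n d (i+1) * TB Q q n d i * TB Q q n d (i+1) := by
  by_cases hj : i + 1 < d
  swap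
  · simp [TB_big Q q n d (i+1) hj]
  obtain ⟨i, rfl⟩ : ∃ m, i = m + 1 := ⟨i - 1, by omega⟩
  refine LinearMap.ext fun f => ?_
  funext c
  have n1 : (⟨i, by omega⟩ : Fin d) ≠ ⟨i+1, by omega⟩ := by simp
  have n2 : (⟨i, by omega⟩ : Fin d) ≠ ⟨i+1+1, by omega⟩ := by simp; omega
  have n3 : (⟨i+1, by omega⟩ : Fin d) ≠ ⟨i+1+1, by omega⟩ := by simp
  simp only [Module.End.mul_apply, TB_apply Q q n d i (by omega), TB_apply Q q n d (i+1) hj]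
  have hQ : q⁻¹ * q = 1 := inv_mul_cancel₀ hq
  generalize (⟨i, by omega⟩ : Fin d) = p1 at *
  generalize (⟨i+1, by omega⟩ : Fin d) = p2 at *
  generalize (⟨i+1+1, by omega⟩ : Fin d) = p3 at *
  simp only [sw_p, sw_p', sw_sw, sw_ne p1 p2 p3 n2.symm n3.symm, sw_ne p2 p3 p1 n1 n2]
  have : sw p1 p2 (sw p2 p3 (sw p1 p2 c)) = sw p2 p3 (sw p1 p2 (sw p2 p3 c)) := by
    funext l; simp only [sw]; grind
  rw [this]
  generalize c p1 = x
  generalize c p2 = y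
  generalize c p3 = z
  simp only [aR, bR]
  rcases lt_trichotomy x y with h | h | h <;> rcases lt_trichotomy y z with h' | h' | h' <;>
    rcases lt_trichotomy x z with h'' | h'' | h'' <;>
    first
    | (exfalso; omega)
    | (try subst h
       try subst h'
       try subst h''
       simp [*, ne_of_lt, ne_of_gt, not_lt_of_gt]
       try ring_nf
       try (simp only [sq, mul_assoc]; grind))

lemma TB_four (Q q : k) (hq : q ≠ 0) (hQ : Q ≠ 0) (n d : ℕ) :
    TB Q q n d 0 * TB Q q n d 1 * TB Q q n d 0 * TB Q q n d 1 =
      TB Q q n d 1 * TB Q q n d 0 * TB Q q n d 1 * TB Q q n d 0 := by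
  by_cases hj : 1 < d
  swap
  · simp [TB_big Q q n d 1 hj]
  refine LinearMap.ext fun f => ?_
  funext c
  have n1 : (⟨0, by omega⟩ : Fin d) ≠ ⟨0+1, by omega⟩ := by simp
  simp only [Module.End.mul_apply, TB0_apply Q q n d (by omega), TB_apply Q q n d 0 hj]
  generalize (⟨0, by omega⟩ : Fin d) = p1 at *
  generalize (⟨0+1, by omega⟩ : Fin d) = p2 at *
  simp only [sw_p, sw_p', sw_sw, fl_p, fl_fl, fl_ne p1 p2 n1.symm, Fin.rev_rev]
  have : fl p1 (sw p1 p2 (fl p1 (sw p1 p2 c))) = sw p1 p2 (fl p1 (sw p1 p2 (fl p1 c))) := by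
    funext l; simp only [fl, sw]; grind
  simp only [this]
  generalize c p1 = x
  generalize c p2 = y
  simp only [aR, bR, aK, bK, val_eq, val_lt, val_rev]
  generalize val n x = x
  generalize val n y = y
  have e1 : Q⁻¹ * Q = 1 := inv_mul_cancel₀ hQ
  have e2 : q⁻¹ * q = 1 := inv_mul_cancel₀ hq
  rcases lt_trichotomy x 0 with h | h | h <;> rcases lt_trichotomy y 0 with h' | h' | h' <;>
    rcases lt_trichotomy x y with h'' | h'' | h'' <;>
    rcases lt_trichotomy x (-y) with h3 | h3 | h3 <;>
    first
    | (exfalso; omega)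
    | (simp (disch := omega) only [if_pos, if_neg, zero_mul, one_mul, add_zero, zero_add, mul_zero]
       first | done | ring1 | (field_simp; ring1) | grind)

lemma TB_BR (Q q : k) (hq : q ≠ 0) (hQ : Q ≠ 0) (n d : ℕ) : BR (TB Q q n d) :=
  ⟨TB_far Q q n d, TB_braid Q q hq n d, TB_four Q q hq hQ n d⟩

lemma JM_eq (Q q : k) (n d : ℕ) : ∀ j, JM Q q n d j = JJ (TB Q q n d) j
  | 0 => rfl
  | 1 => rfl
  | i + 2 => by rw [JM, JJ, JM_eq Q q n d (i+1)]

end conc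

section fin
variable {n d : ℕ}

abbrev LA (q : ℂ) (n d : ℕ) : ℕ → Module.End ℂ ((Fin d → Fin n) → ℂ) := JJ (tA (TB 1 q n d))

lemma tA_indep (Q Q' q : ℂ) (n d : ℕ) : tA (TB Q q n d) = tA (TB Q' q n d) := by
  funext i
  by_cases h : i = 0
  · simp [tA, h]
  · simp only [tA, h, if_false]
    unfold TB
    rw [dif_neg h, dif_neg h]

lemma TB_sym (Q : ℂ) (q : ℂ) (hq : star q = q) (i : ℕ) (hi : 1 ≤ i) : Sym (TB Q q n d i) := by
  by_cases hd : i < d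
  swap
  · rw [TB_big Q q n d i hd]; intro x y; simp
  obtain ⟨i, rfl⟩ : ∃ m, i = m + 1 := ⟨i - 1, by omega⟩
  intro x y
  simp only [dotProduct, TB_apply Q q n d i hd, Pi.star_apply]
  generalize (⟨i, by omega⟩ : Fin d) = p1
  generalize (⟨i+1, by omega⟩ : Fin d) = p2
  simp only [mul_add, star_add, star_mul', add_mul, Finset.sum_add_distrib]
  have ha : ∀ a b : Fin n, star (aR q a b) = aR q a b := by
    intro a b; unfold aR
    have : star q⁻¹ = q⁻¹ := by rw [star_inv₀, hq]
    split_ifs <;> simp only [star_sub, hq, this, star_zero]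
  have hb : ∀ a b : Fin n, star (bR ℂ a b) = bR ℂ a b := by
    intro a b; unfold bR; split_ifs <;> simp
  congr 1
  · refine Finset.sum_congr rfl fun c _ => ?_
    rw [ha]; ring
  · have hinv : Function.Involutive (sw p1 p2 : (Fin d → Fin n) → _) := sw_sw p1 p2
    rw [← Equiv.sum_comp hinv.toPerm]
    refine Finset.sum_congr rfl fun c _ => ?_
    simp only [Function.Involutive.coe_toPerm, sw_sw, sw_p, sw_p', hb]
    have : bR ℂ (c p2) (c p1) = bR ℂ (c p1) (c p2) := by simp [bR, eq_comm]
    rw [this]; ring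

lemma LA_sym (q : ℂ) (hq : star q = q) (j : ℕ) (hj : 1 ≤ j) : Sym (LA q n d j) := by
  induction j, hj using Nat.le_induction with
  | base => intro x y; simp [LA, JJ, tA]
  | succ j hj ih =>
    rw [LA, JJ_succ _ j hj]
    have e : tA (TB 1 q n d) j = TB 1 q n d j := by simp [tA]; omega
    rw [e]
    exact Sym.sandwich ih (TB_sym 1 q hq j hj)

def lst (q : ℂ) (d : ℕ) : List ℂ := ((Finset.Icc (-(d:ℤ)) d).toList).map (fun m => q ^ (2 * m))

lemma LA_real (q : ℂ) (hq : star q = q) (hq0 : q ≠ 0) (j : ℕ) (hj : 1 ≤ j) (hjd : j ≤ d) :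
    PP (LA q n d j) (lst q d) = 0 := by
  apply (LA_sym q hq j hj).PP_zero
  · intro s hs
    obtain ⟨m, _, rfl⟩ := List.mem_map.1 hs
    rw [star_zpow₀, hq]
  · intro c v hv hc
    obtain ⟨m, hm, rfl⟩ := eigA (BR_tA (TB_BR 1 q hq0 one_ne_zero n d)) q hq0 (by simp [tA]) d
      (fun i h1 h2 => by
        have e : tA (TB 1 q n d) i = TB 1 q n d i := by simp [tA]; omega
        rw [e]; exact TB_quad 1 q hq0 n d i h1 h2) j hj hjd c v hv hc
    refine List.mem_map.2 ⟨m, ?_, rfl⟩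
    rw [Finset.mem_toList, Finset.mem_Icc]
    have := abs_lt.1 hm
    omega

def DD (x : ℂ → (Fin d → Fin n) → ℂ) : Prop := ∀ c, DifferentiableOn ℂ (fun q => x q c) {0}ᶜ

lemma diff_inv : DifferentiableOn ℂ (fun q : ℂ => q⁻¹) {0}ᶜ := 
  fun x hx => (differentiableAt_inv hx).differentiableWithinAt

lemma DD_TB {x : ℂ → (Fin d → Fin n) → ℂ} (hx : DD x) (i : ℕ) (hi : 1 ≤ i) :
    DD (fun q => TB 1 q n d i (x q)) := by
  intro c
  by_cases hd : i < d
  swap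
  · simp only [TB_big _ _ n d i hd, LinearMap.zero_apply, Pi.zero_apply]
    exact differentiableOn_const _
  obtain ⟨i, rfl⟩ : ∃ m, i = m + 1 := ⟨i - 1, by omega⟩
  simp only [TB_apply (1:ℂ) _ n d i hd]
  refine DifferentiableOn.add (DifferentiableOn.mul ?_ (hx _)) ((hx _).const_mul _)
  unfold aR
  split_ifs
  · exact diff_inv
  · exact diff_inv.sub differentiableOn_id
  · exact differentiableOn_const _

lemma DD_LA (j : ℕ) (hj : 1 ≤ j) : ∀ {x : ℂ → (Fin d → Fin n) → ℂ}, DD x →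
    DD (fun q => LA q n d j (x q)) := by
  induction j, hj using Nat.le_induction with
  | base => intro x hx; simpa [LA, JJ, tA] using hx
  | succ j hj ih =>
    intro x hx
    have e : ∀ q, LA q n d (j+1) (x q) = TB 1 q n d j (LA q n d j (TB 1 q n d j (x q))) := by
      intro q
      have e : tA (TB 1 q n d) j = TB 1 q n d j := by simp [tA]; omega
      rw [LA, JJ_succ _ j hj, e]; rfl
    simp only [e]
    exact DD_TB (ih (DD_TB hx j hj)) j hj

lemma DD_PP (j : ℕ) (hj : 1 ≤ j) (ms : List ℤ) (x : (Fin d → Fin n) → ℂ) :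
    DD (fun q => PP (LA q n d j) (ms.map (fun m => q ^ (2 * m))) x) := by
  induction ms with
  | nil => intro c; simp only [List.map_nil, PP, List.prod_nil, Module.End.one_apply]
           exact differentiableOn_const _
  | cons m ms ih =>
    simp only [List.map_cons, PP_cons]
    intro c
    simp only [Pi.sub_apply, Pi.smul_apply, smul_eq_mul]
    refine DifferentiableOn.sub (DD_LA j hj ih c) (DifferentiableOn.mul ?_ (ih c))
    intro y hy
    exact (differentiableAt_zpow.2 (Or.inl hy)).differentiableWithinAt

lemma LA_gen (q : ℂ) (hq0 : q ≠ 0) (j : ℕ) (hj : 1 ≤ j) (hjd : j ≤ d) :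
    PP (LA q n d j) (lst q d) = 0 := by
  refine LinearMap.ext fun x => ?_
  funext c
  have hD := DD_PP (n := n) (d := d) j hj ((Finset.Icc (-(d:ℤ)) d).toList) x c
  have hA := hD.analyticOnNhd isOpen_compl_singleton
  have hpre : IsPreconnected ({0}ᶜ : Set ℂ) :=
    (isConnected_compl_singleton_of_one_lt_rank (by simp) 0).isPreconnected
  have hfreq : ∃ᶠ z in nhdsWithin (1:ℂ) {1}ᶜ, 
      (fun q => PP (LA q n d j) (((Finset.Icc (-(d:ℤ)) d).toList).map (fun m => q ^ (2 * m))) x c) z = 0 := by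
    have ht : Filter.Tendsto (fun k : ℕ => (((1 + 1 / ((k:ℝ) + 1) : ℝ)) : ℂ)) Filter.atTop
        (nhdsWithin (1:ℂ) {1}ᶜ) := by
      rw [tendsto_nhdsWithin_iff]
      constructor
      · have h1 : Filter.Tendsto (fun k : ℕ => (1 + 1 / ((k:ℝ) + 1) : ℝ)) Filter.atTop (nhds 1) := by
          simpa using (tendsto_one_div_add_atTop_nhds_zero_nat (𝕜 := ℝ)).const_add 1
        have h2 := (Complex.continuous_ofReal.tendsto 1).comp h1
        simpa [Function.comp_def] using h2
      · refine Filter.Eventually.of_forall fun k => ?_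
        have hp : (0:ℝ) < 1 / ((k:ℝ) + 1) := by positivity
        simp only [Set.mem_compl_iff, Set.mem_singleton_iff]
        intro h
        have : (1 + 1 / ((k:ℝ) + 1) : ℝ) = 1 := by exact_mod_cast h
        linarith
    refine ht.frequently (Filter.Frequently.of_forall fun k => ?_)
    have hp : (0:ℝ) < 1 + 1 / ((k:ℝ) + 1) := by positivity
    have := LA_real (n := n) (d := d) ((1 + 1 / ((k:ℝ) + 1) : ℝ) : ℂ) (Complex.conj_ofReal _)
      (by exact_mod_cast hp.ne') j hj hjd
    have h2 := congrFun (LinearMap.congr_fun this x) c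
    exact h2
  have := hA.eqOn_zero_of_preconnected_of_frequently_eq_zero hpre (z₀ := 1) (by simp) hfreq
  exact this (show q ∈ ({0}ᶜ : Set ℂ) from hq0)

lemma main_aux (Q q : ℂ) (hQ : Q ≠ 0) (hq : q ≠ 0)
    (hgen : ∀ a b : ℤ, (a, b) ≠ (0, 0) → Q ^ a * q ^ b ≠ 1) (n d : ℕ) (hd : 1 ≤ d)
    (a b : ℂ) (ha : a ≠ 0) (hab : ∀ m : ℤ, a * q ^ (2 * m) ≠ b)
    (h0 : (TB Q q n d 0 - a • 1) * (TB Q q n d 0 - b • 1) = 0) :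
    LinearMap.range (UU (TB Q q n d) b d) = Submodule.span ℂ
          {v : (Fin d → Fin n) → ℂ | v ≠ 0 ∧
            ∀ j : ℕ, 1 ≤ j → j ≤ d → ∃ m : ℤ, JM Q q n d j v = (a * q ^ (2 * m)) • v} := by
  have hBR := TB_BR Q q hq hQ n d
  apply le_antisymm
  · have hnd : (lst q d).Nodup := by
      refine List.Nodup.map ?_ (Finset.nodup_toList _)
      intro m m' h
      by_contra hne
      refine hgen 0 (2 * m - 2 * m') ?_ ?_
      · intro h'
        have := (Prod.mk.inj h').2
        omega
      · simp only at h
        rw [zpow_zero, one_mul, zpow_sub₀ hq, h, div_self (zpow_ne_zero _ hq)]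
    have := joint (JJ (TB Q q n d)) (LA q n d) (LinearMap.range (UU (TB Q q n d) b d)) a d (lst q d) hnd
      (by
        rintro j h1 h2 _ ⟨x, rfl⟩
        refine ⟨JJ (TB Q q n d) j x, ?_⟩
        exact (LinearMap.congr_fun (comm_JU hBR b j h1 d).eq x).symm)
      (fun i j hi hj => comm_J' hBR i j hi hj) ha
      (by
        rintro j h1 h2 _ ⟨x, rfl⟩
        have := JU_eq hBR a b (q⁻¹ - q) h0 d (fun i h h' => TB_quad Q q hq n d i h h') j h1 h2
        rw [tA_indep Q 1] at this
        exact LinearMap.congr_fun this x)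
      (fun j h1 h2 => LA_gen q hq j h1 h2) d le_rfl
    refine this.trans ?_
    rw [← Submodule.span_sdiff_singleton_zero]
    refine Submodule.span_mono ?_
    rintro v ⟨⟨_, hv⟩, hv0⟩
    refine ⟨hv0, fun j h1 h2 => ?_⟩
    obtain ⟨s, hs, h3⟩ := hv j h1 h2
    obtain ⟨m, _, rfl⟩ := List.mem_map.1 hs
    exact ⟨m, by rw [JM_eq]; exact h3⟩
  · rw [Submodule.span_le]
    rintro v ⟨_, hv⟩
    have : ∀ k, k ≤ d → ∃ c : ℂ, c ≠ 0 ∧ UU (TB Q q n d) b k v = c • v := by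
      intro k
      induction k with
      | zero => intro _; exact ⟨1, one_ne_zero, by simp [UU]⟩
      | succ k ih =>
        intro hk
        obtain ⟨c, hc, hcv⟩ := ih (by omega)
        obtain ⟨m, hm⟩ := hv (k+1) (by omega) hk
        refine ⟨(a * q ^ (2*m) - b) * c, mul_ne_zero (sub_ne_zero.2 (hab m)) hc, ?_⟩
        rw [JM_eq] at hm
        rw [UU_succ, Module.End.mul_apply, LinearMap.sub_apply, hm, LinearMap.smul_apply,
          Module.End.one_apply, ← sub_smul, map_smul, hcv, smul_smul]
    obtain ⟨c, hc, hcv⟩ := this d le_rfl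
    exact ⟨c⁻¹ • v, by rw [map_smul, hcv, smul_smul, inv_mul_cancel₀ hc, one_smul]⟩

end fin

/-- Over `ℂ` with generic `Q, q`, let
`u_d^+ = ∏_{j=1}^d (K_j + Q)` and `u_d^- = ∏_{j=1}^d (K_j - Q⁻¹)` as
endomorphisms of `V_n^{⊗d}`.  Then the image of `u_d^+` is the span of all
(nonzero) simultaneous eigenvectors of `K_1, …, K_d` whose eigenvalues all have
the form `Q⁻¹ q^{2m}` (`m ∈ ℤ`), and the image of `u_d^-` is the span of all
simultaneous eigenvectors whose eigenvalues all have the form `-Q q^{2m}`. -/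
theorem range_u_plus_minus
    (Q q : ℂ) (hQ : Q ≠ 0) (hq : q ≠ 0)
    (hgen : ∀ a b : ℤ, (a, b) ≠ (0, 0) → Q ^ a * q ^ b ≠ 1)
    (n d : ℕ) (hn : 1 ≤ n) (hd : 1 ≤ d) :
    LinearMap.range
        (((List.range d).map
          (fun j => JM Q q n d (j + 1) + Q • (1 : Module.End ℂ ((Fin d → Fin n) → ℂ)))).prod)
      = Submodule.span ℂ
          {v : (Fin d → Fin n) → ℂ | v ≠ 0 ∧
            ∀ j : ℕ, 1 ≤ j → j ≤ d → ∃ m : ℤ, JM Q q n d j v = (Q⁻¹ * q ^ (2 * m)) • v} ∧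
    LinearMap.range
        (((List.range d).map
          (fun j => JM Q q n d (j + 1) - Q⁻¹ • (1 : Module.End ℂ ((Fin d → Fin n) → ℂ)))).prod)
      = Submodule.span ℂ
          {v : (Fin d → Fin n) → ℂ | v ≠ 0 ∧
            ∀ j : ℕ, 1 ≤ j → j ≤ d → ∃ m : ℤ, JM Q q n d j v = (-(Q * q ^ (2 * m))) • v} := by
  have hquad := TB0_quad Q q hQ n d hd
  have hQQ : Q⁻¹ * Q = 1 := inv_mul_cancel₀ hQ
  have hne : ∀ (m : ℤ) (e : ℤ), e ≠ 0 → Q ^ e * q ^ (2 * m) ≠ -1 := by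
    intro m e he h
    refine hgen (2 * e) (4 * m) (by simp [he]) ?_
    have : Q ^ (2 * e) * q ^ (4 * m) = (Q ^ e * q ^ (2 * m)) * (Q ^ e * q ^ (2 * m)) := by
      rw [show 2 * e = e + e by ring, show 4 * m = 2 * m + 2 * m by ring, zpow_add₀ hQ, zpow_add₀ hq]
      ring
    rw [this, h]; ring
  constructor
  · have := main_aux Q q hQ hq hgen n d hd Q⁻¹ (-Q) (inv_ne_zero hQ) (by
      intro m h
      refine hne m (-2) (by norm_num) ?_
      rw [show (-2 : ℤ) = -1 + -1 by ring, zpow_add₀ hQ, zpow_neg_one]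
      linear_combination Q⁻¹ * h - hQQ) (by
      simp only [sub_mul, mul_sub, hquad, smul_mul_assoc, mul_smul_comm, one_mul, mul_one, smul_sub, smul_smul]
      rw [neg_mul, mul_comm, hQQ]
      module)
    rw [← this]
    congr 2
    refine List.map_congr_left fun j _ => ?_
    rw [JM_eq]; module
  · have := main_aux Q q hQ hq hgen n d hd (-Q) Q⁻¹ (neg_ne_zero.2 hQ) (by
      intro m h
      refine hne m 2 (by norm_num) ?_
      rw [show (2 : ℤ) = 1 + 1 by ring, zpow_add₀ hQ, zpow_one]
      rw [show (1 + 1 : ℤ) = 2 by ring]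
      linear_combination -Q * h - hQQ) (by
      simp only [sub_mul, mul_sub, hquad, smul_mul_assoc, mul_smul_comm, one_mul, mul_one, smul_sub, smul_smul]
      rw [mul_neg, hQQ]
      module)
    simp only [neg_mul] at this
    rw [← this]
    congr 2
    refine List.map_congr_left fun j _ => ?_
    rw [JM_eq]

end QSP
end
end

section
/- For every 1 ≤ i ≤ d and every w ∈ V_n^{⊗d}: (K_i − Q^{−1} q^{2−2i}) w ∈ N(S^d_+); (K_i + Q q^{2−2i}) w ∈ N(S^d_−); (K_i − Q^{−1} q^{2i−2}) w ∈ N(∧^d_+); and (K_i + Q q^{2i−2}) w ∈ N(∧^d_−). Equivalently, each K_i induces on the quotients S^d_+ V_n, S^d_− V_n, ∧^d_+ V_n, ∧^d_− V_n multiplication by the scalar Q^{−1} q^{2−2i}, −Q q^{2−2i}, Q^{−1} q^{2i−2}, −Q q^{2i−2}, respectively. -/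
noncomputable section
namespace QSP

variable {k : Type*} [Field k]

/-- The subspace of `V_n^{⊗d}` spanned by all vectors `(T_0 - c₀)w` and
`(T_i - c₁)w` for `0 < i < d`; the quotient by it is (according to the choice of
`c₀ ∈ {Q⁻¹, -Q}` and `c₁ ∈ {q⁻¹, -q}`) one of `S^d_± V_n`, `∧^d_± V_n`. -/
def relSpan (Q q : k) (n d : ℕ) (c₀ c₁ : k) : Submodule k ((Fin d → Fin n) → k) :=
  Submodule.span k
    {x | (∃ w, x = TB Q q n d 0 w - c₀ • w) ∨
         ∃ i, 0 < i ∧ i < d ∧ ∃ w, x = TB Q q n d i w - c₁ • w}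

theorem JM_aux (Q q : k) (n d : ℕ) (c₀ c₁ : k) :
    ∀ i : ℕ, i + 1 ≤ d → ∀ w : (Fin d → Fin n) → k,
      JM Q q n d (i + 1) w - (c₀ * (c₁ * c₁) ^ i) • w ∈ relSpan Q q n d c₀ c₁ := by
  intro i
  induction i with
  | zero =>
    intro _ w
    apply Submodule.subset_span
    left
    exact ⟨w, by simp [JM]⟩
  | succ i ih =>
    intro hi w
    have hT : ∀ v, TB Q q n d (i + 1) v - c₁ • v ∈ relSpan Q q n d c₀ c₁ := fun v =>
      Submodule.subset_span (Or.inr ⟨i + 1, by omega, by omega, v, rfl⟩)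
    have h1 := hT (JM Q q n d (i + 1) (TB Q q n d (i + 1) w))
    have h2 := Submodule.smul_mem _ c₁ (ih (by omega) (TB Q q n d (i + 1) w))
    have h3 := Submodule.smul_mem _ (c₁ * (c₀ * (c₁ * c₁) ^ i)) (hT w)
    have h := Submodule.add_mem _ (Submodule.add_mem _ h1 h2) h3
    convert h using 1
    simp only [JM, Module.End.mul_apply]
    module

/-- For `1 ≤ i ≤ d` and `w ∈ V_n^{⊗d}`:
`(K_i - Q⁻¹q^{2-2i})w ∈ N(S^d_+)`, `(K_i + Qq^{2-2i})w ∈ N(S^d_-)`,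
`(K_i - Q⁻¹q^{2i-2})w ∈ N(∧^d_+)` and `(K_i + Qq^{2i-2})w ∈ N(∧^d_-)`;
i.e. `K_i` acts on the quotients `S^d_± V_n`, `∧^d_± V_n` by the scalars
`Q⁻¹q^{2-2i}`, `-Qq^{2-2i}`, `Q⁻¹q^{2i-2}`, `-Qq^{2i-2}` respectively. -/
theorem JM_scalar_on_sym_ext
    (Q q : k) (hQ : Q ≠ 0) (hq : q ≠ 0) (n d : ℕ) (hn : 1 ≤ n) (hd : 1 ≤ d) :
    ∀ i : ℕ, 1 ≤ i → i ≤ d → ∀ w : (Fin d → Fin n) → k,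
      (JM Q q n d i w - (Q⁻¹ * q ^ ((2 : ℤ) - 2 * i)) • w ∈ relSpan Q q n d Q⁻¹ q⁻¹) ∧
      (JM Q q n d i w + (Q * q ^ ((2 : ℤ) - 2 * i)) • w ∈ relSpan Q q n d (-Q) q⁻¹) ∧
      (JM Q q n d i w - (Q⁻¹ * q ^ (2 * (i : ℤ) - 2)) • w ∈ relSpan Q q n d Q⁻¹ (-q)) ∧
      (JM Q q n d i w + (Q * q ^ (2 * (i : ℤ) - 2)) • w ∈ relSpan Q q n d (-Q) (-q)) := by
  intro i hi hid w
  obtain ⟨j, rfl⟩ : ∃ j, i = j + 1 := ⟨i - 1, by omega⟩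
  have e1 : q ^ ((2 : ℤ) - 2 * ((j + 1 : ℕ) : ℤ)) = (q⁻¹ * q⁻¹) ^ j := by
    have : (2 : ℤ) - 2 * ((j + 1 : ℕ) : ℤ) = -((2 * j : ℕ) : ℤ) := by push_cast; ring
    rw [this, zpow_neg, zpow_natCast, pow_mul, ← mul_inv, inv_pow, pow_two]
  have e2 : q ^ (2 * ((j + 1 : ℕ) : ℤ) - 2) = (-q * -q) ^ j := by
    have : 2 * ((j + 1 : ℕ) : ℤ) - 2 = ((2 * j : ℕ) : ℤ) := by push_cast; ring
    rw [this, zpow_natCast, pow_mul, neg_mul_neg, pow_two]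
  rw [e1, e2]
  refine ⟨JM_aux Q q n d _ _ j hid w, ?_, JM_aux Q q n d _ _ j hid w, ?_⟩
  · have h := JM_aux Q q n d (-Q) q⁻¹ j hid w
    rwa [neg_mul, neg_smul, sub_neg_eq_add] at h
  · have h := JM_aux Q q n d (-Q) (-q) j hid w
    rwa [neg_mul Q, neg_smul, sub_neg_eq_add] at h

end QSP
end
end
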